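/- arXiv:2102.03321 — 3 statements merged into one kernel-verified Lean document; each statement's English description precedes it below -/
import Mathlib

section
/- There exists a multiway system M whose growth function satisfies g_M ∈ Θ(√n): there are constants 0 < c ≤ C and N such that c·√n ≤ g_M(n) ≤ C·√n for all n ≥ N. In particular the class of multiway systems with growth rate the inverse of a polynomial is nonempty. -/
/-- A (string-based) multiway system: a finite set of rewrite rules together with an
initial string.  Symbols are modelled as natural numbers; since rules and the initial
string are finite, only finitely many symbols (the effective alphabet) occur. -/
structure Multiway where
  rules : Finset (List ℕ × List ℕ)
  init : List ℕ

/-- One rewrite step: `x = u ++ r ++ v` and `y = u ++ t ++ v` for some rule `(r, t)`. -/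
def Multiway.Step (M : Multiway) (x y : List ℕ) : Prop :=
  ∃ p ∈ M.rules, ∃ u v : List ℕ, x = u ++ p.1 ++ v ∧ y = u ++ p.2 ++ v

/-- Reachability from the initial string by a chain of exactly `n` rewrite steps. -/
def Multiway.StepN (M : Multiway) : ℕ → List ℕ → Prop
  | 0 => fun x => x = M.init
  | n + 1 => fun y => ∃ x, M.StepN n x ∧ M.Step x y

/-- The set of strings whose shortest rewrite distance from the initial string is exactly `n`. -/
def Multiway.sphere (M : Multiway) (n : ℕ) : Set (List ℕ) :=
  {x | M.StepN n x ∧ ∀ k < n, ¬ M.StepN k x}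

/-- The growth function of a multiway system: the number of strings whose shortest
rewrite distance from the initial string is exactly `n`.  (`growth M 0 = 1`.) -/
noncomputable def Multiway.growth (M : Multiway) (n : ℕ) : ℕ :=
  (M.sphere n).ncard

/-- Reachable states of a multiway system. -/
def Multiway.Reachable (M : Multiway) (x : List ℕ) : Prop :=
  Relation.ReflTransGen M.Step M.init x

/-- The symbols actually used by a multiway system (its effective alphabet). -/
def Multiway.symbols (M : Multiway) : Finset ℕ :=
  M.init.toFinset ∪ M.rules.biUnion fun p => p.1.toFinset ∪ p.2.toFinset

/-- The bouncing head: `2` and `3` are a head moving right or left on a tape of `0`s between two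
walls `1`.  Bouncing off the right wall either lengthens the tape by one cell, or replaces the
head and the wall by `4`, which then emits `0`s forever. -/
def bouncer : Multiway where
  rules := {([2, 0], [0, 2]), ([2, 1], [3, 0, 1]), ([2, 1], [4]),
    ([0, 3], [3, 0]), ([1, 3], [1, 2]), ([4], [4, 0])}
  init := [1, 2, 1]

namespace bouncer

/-- The tape with the head moving right. -/
def rightWord (i j : ℕ) : List ℕ := (1 :: List.replicate i 0) ++ 2 :: (List.replicate j 0 ++ [1])

/-- The tape with the head moving left. -/
def leftWord (i j : ℕ) : List ℕ :=
  (1 :: List.replicate i 0) ++ 3 :: (List.replicate (j + 1) 0 ++ [1])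

/-- A word that has left the bouncing regime. -/
def freeWord (m k : ℕ) : List ℕ := (1 :: List.replicate m 0) ++ 4 :: List.replicate k 0

/-- The words reachable in exactly `n` steps, described explicitly. -/
inductive Layer : ℕ → List ℕ → Prop
  | right (i j n : ℕ) (h : n = (i + j) * (i + j + 1) + i) : Layer n (rightWord i j)
  | left (i j n : ℕ) (h : n = (i + j + 1) ^ 2 + j) : Layer n (leftWord i j)
  | free (m k n : ℕ) (h : n = (m + 1) ^ 2 + k) : Layer n (freeWord m k)

theorem append_cons_inj_of_lt {a b u v : List ℕ} {h h' : ℕ} (ha : ∀ x ∈ a, x < 2)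
    (hb : ∀ x ∈ b, x < 2) (hh : 2 ≤ h) (e : u ++ h :: v = a ++ h' :: b) :
    u = a ∧ h = h' ∧ v = b := by
  induction a generalizing u with
  | nil =>
    cases u with
    | nil => simpa using e
    | cons c u =>
      simp only [List.cons_append, List.nil_append, List.cons.injEq] at e
      have := hb h (by simp [← e.2])
      omega
  | cons c a ih =>
    cases u with
    | nil =>
      simp only [List.cons_append, List.nil_append, List.cons.injEq] at e
      have := ha c (by simp)
      omega
    | cons d u =>
      simp only [List.cons_append, List.cons.injEq] at e
      obtain ⟨h1, h2, h3⟩ := ih (fun x hx => ha x (by simp [hx])) e.2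
      exact ⟨by rw [e.1, h1], h2, h3⟩

theorem lt_two_of_mem_left (i : ℕ) : ∀ x ∈ 1 :: List.replicate i 0, x < 2 := by
  intro x hx
  simp only [List.mem_cons, List.mem_replicate] at hx
  omega

theorem lt_two_of_mem_right (j : ℕ) : ∀ x ∈ List.replicate j 0 ++ [1], x < 2 := by
  intro x hx
  simp only [List.mem_append, List.mem_singleton, List.mem_replicate] at hx
  omega

theorem lt_two_of_mem_replicate (j : ℕ) : ∀ x ∈ List.replicate j 0, x < 2 := by
  intro x hx
  simp only [List.mem_replicate] at hx
  omega

theorem eq_rightWord {u v : List ℕ} {h i j : ℕ} (hh : 2 ≤ h) (e : rightWord i j = u ++ h :: v) :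
    u = 1 :: List.replicate i 0 ∧ h = 2 ∧ v = List.replicate j 0 ++ [1] :=
  append_cons_inj_of_lt (lt_two_of_mem_left i) (lt_two_of_mem_right j) hh e.symm

theorem eq_leftWord {u v : List ℕ} {h i j : ℕ} (hh : 2 ≤ h) (e : leftWord i j = u ++ h :: v) :
    u = 1 :: List.replicate i 0 ∧ h = 3 ∧ v = List.replicate (j + 1) 0 ++ [1] :=
  append_cons_inj_of_lt (lt_two_of_mem_left i) (lt_two_of_mem_right (j + 1)) hh e.symm

theorem eq_freeWord {u v : List ℕ} {h m k : ℕ} (hh : 2 ≤ h) (e : freeWord m k = u ++ h :: v) :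
    u = 1 :: List.replicate m 0 ∧ h = 4 ∧ v = List.replicate k 0 :=
  append_cons_inj_of_lt (lt_two_of_mem_left m) (lt_two_of_mem_replicate k) hh e.symm

theorem step_iff {x y : List ℕ} : bouncer.Step x y ↔ ∃ u v,
    (x = u ++ 2 :: 0 :: v ∧ y = u ++ 0 :: 2 :: v) ∨
    (x = u ++ 2 :: 1 :: v ∧ y = u ++ 3 :: 0 :: 1 :: v) ∨
    (x = u ++ 2 :: 1 :: v ∧ y = u ++ 4 :: v) ∨
    (x = (u ++ [0]) ++ 3 :: v ∧ y = u ++ 3 :: 0 :: v) ∨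
    (x = (u ++ [1]) ++ 3 :: v ∧ y = u ++ 1 :: 2 :: v) ∨
    (x = u ++ 4 :: v ∧ y = u ++ 4 :: 0 :: v) := by
  simp [Multiway.Step, bouncer, exists_or]

theorem cons_replicate_eq_append_zero {u : List ℕ} {i : ℕ}
    (h : u ++ [0] = 1 :: List.replicate i 0) :
    ∃ i', i = i' + 1 ∧ u = 1 :: List.replicate i' 0 := by
  cases i with
  | zero =>
    have := congrArg List.getLast? h
    simp at this
  | succ i =>
    refine ⟨i, rfl, ?_⟩
    rw [List.replicate_succ', ← List.cons_append] at h
    exact List.append_cancel_right h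

theorem cons_replicate_eq_append_one {u : List ℕ} {i : ℕ}
    (h : u ++ [1] = 1 :: List.replicate i 0) : i = 0 ∧ u = [] := by
  cases i with
  | zero => simpa using h
  | succ i =>
    rw [List.replicate_succ', ← List.cons_append] at h
    simpa using List.append_inj_right' h rfl

theorem Layer.step {n : ℕ} {x y : List ℕ} (hx : Layer n x) (hs : bouncer.Step x y) :
    Layer (n + 1) y := by
  obtain ⟨u, v, hs⟩ := step_iff.1 hs
  cases hx with
  | right i j _ h =>
    rcases hs with ⟨e, rfl⟩ | ⟨e, rfl⟩ | ⟨e, rfl⟩ | ⟨e, rfl⟩ | ⟨e, rfl⟩ | ⟨e, rfl⟩ <;>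
      obtain ⟨hu, hh, hv⟩ := eq_rightWord (by norm_num) e
    · rcases j with _ | j
      · simp at hv
      · obtain rfl : v = List.replicate j 0 ++ [1] := by simpa [List.replicate_succ] using hv
        have hw : u ++ 0 :: 2 :: (List.replicate j 0 ++ [1]) = rightWord (i + 1) j := by
          simp [hu, rightWord, List.replicate_succ']
        exact hw ▸ .right (i + 1) j _ (by linarith)
    · rcases j with _ | j
      · obtain rfl : v = [] := by simpa using hv
        exact hu ▸ .left i 0 _ (by linarith)
      · simp [List.replicate_succ] at hv
    · rcases j with _ | j
      · obtain rfl : v = [] := by simpa using hv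
        exact hu ▸ .free i 0 _ (by linarith)
      · simp [List.replicate_succ] at hv
    all_goals omega
  | left i j _ h =>
    rcases hs with ⟨e, rfl⟩ | ⟨e, rfl⟩ | ⟨e, rfl⟩ | ⟨e, rfl⟩ | ⟨e, rfl⟩ | ⟨e, rfl⟩ <;>
      obtain ⟨hu, hh, hv⟩ := eq_leftWord (by norm_num) e
    · omega
    · omega
    · omega
    · obtain ⟨i, rfl, rfl⟩ := cons_replicate_eq_append_zero hu
      exact hv ▸ .left i (j + 1) _ (by linarith)
    · obtain ⟨rfl, rfl⟩ := cons_replicate_eq_append_one hu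
      exact hv ▸ .right 0 (j + 1) _ (by linarith)
    · omega
  | free m k _ h =>
    rcases hs with ⟨e, rfl⟩ | ⟨e, rfl⟩ | ⟨e, rfl⟩ | ⟨e, rfl⟩ | ⟨e, rfl⟩ | ⟨e, rfl⟩ <;>
      obtain ⟨hu, hh, hv⟩ := eq_freeWord (by norm_num) e
    · omega
    · omega
    · omega
    · omega
    · omega
    · exact hu ▸ hv ▸ .free m (k + 1) _ (by linarith)

theorem Layer.stepN {n : ℕ} {x : List ℕ} (hx : Layer n x) : bouncer.StepN n x := by
  induction n generalizing x with
  | zero =>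
    cases hx with
    | right i j _ h =>
      obtain ⟨rfl, rfl⟩ : i = 0 ∧ j = 0 := by
        constructor <;> nlinarith
      rfl
    | left i j _ h => exact absurd h (by positivity)
    | free m k _ h => exact absurd h (by positivity)
  | succ n ih =>
    suffices ∃ w, Layer n w ∧ bouncer.Step w x by
      obtain ⟨w, hw, hs⟩ := this
      exact ⟨w, ih hw, hs⟩
    simp only [step_iff]
    cases hx with
    | right i j _ h =>
      rcases i with _ | i
      · rcases j with _ | j
        · simp at h
        · exact ⟨_, .left 0 j n (by linarith), [], _, .inr <| .inr <| .inr <| .inr <| .inl ⟨rfl, rfl⟩⟩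
      · exact ⟨_, .right i (j + 1) n (by linarith), 1 :: List.replicate i 0, _,
          .inl ⟨rfl, by simp [rightWord, List.replicate_succ']⟩⟩
    | left i j _ h =>
      rcases j with _ | j
      · exact ⟨_, .right i 0 n (by linarith), _, _, .inr <| .inl ⟨rfl, rfl⟩⟩
      · exact ⟨_, .left (i + 1) j n (by linarith), 1 :: List.replicate i 0, _,
          .inr <| .inr <| .inr <| .inl ⟨by simp [leftWord, List.replicate_succ'], rfl⟩⟩
    | free m k _ h =>
      rcases k with _ | k
      · exact ⟨_, .right m 0 n (by linarith), _, _, .inr <| .inr <| .inl ⟨rfl, rfl⟩⟩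
      · exact ⟨_, .free m k n (by linarith), _, _,
          .inr <| .inr <| .inr <| .inr <| .inr ⟨rfl, rfl⟩⟩

theorem stepN_iff_layer {n : ℕ} {x : List ℕ} : bouncer.StepN n x ↔ Layer n x := by
  refine ⟨fun hx => ?_, Layer.stepN⟩
  induction n generalizing x with
  | zero =>
    obtain rfl : x = rightWord 0 0 := hx
    exact .right 0 0 0 rfl
  | succ n ih =>
    obtain ⟨w, hw, hs⟩ := hx
    exact (ih hw).step hs

theorem replicate_append_one_inj {j j' : ℕ}
    (h : List.replicate j 0 ++ [1] = List.replicate j' 0 ++ [1]) : j = j' := by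
  simpa using congrArg List.length h

theorem cons_replicate_inj {i i' : ℕ}
    (h : 1 :: List.replicate i 0 = 1 :: List.replicate i' 0) : i = i' := by
  simpa using congrArg List.length h

theorem freeWord_inj {m k m' k' : ℕ} (h : freeWord m k = freeWord m' k') : m = m' ∧ k = k' := by
  obtain ⟨h1, -, h2⟩ := eq_freeWord (by norm_num) h
  exact ⟨(cons_replicate_inj h1).symm, by simpa using (congrArg List.length h2).symm⟩

theorem Layer.unique {n n' : ℕ} {x : List ℕ} (hx : Layer n x) (hx' : Layer n' x) : n = n' := by
  cases hx with
  | right i j _ h =>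
    generalize e : rightWord i j = x at hx'
    cases hx' with
    | right i' j' _ h' =>
      obtain ⟨h1, -, h2⟩ := eq_rightWord (by norm_num) e
      rw [h, h', cons_replicate_inj h1, replicate_append_one_inj h2]
    | left i' j' _ h' => simpa using (eq_rightWord (by norm_num) e).2.1
    | free m k _ h' => simpa using (eq_rightWord (by norm_num) e).2.1
  | left i j _ h =>
    generalize e : leftWord i j = x at hx'
    cases hx' with
    | right i' j' _ h' => simpa using (eq_leftWord (by norm_num) e).2.1
    | left i' j' _ h' =>
      obtain ⟨h1, -, h2⟩ := eq_leftWord (by norm_num) e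
      rw [h, h', cons_replicate_inj h1, Nat.succ_injective (replicate_append_one_inj h2)]
    | free m k _ h' => simpa using (eq_leftWord (by norm_num) e).2.1
  | free m k _ h =>
    generalize e : freeWord m k = x at hx'
    cases hx' with
    | right i' j' _ h' => simpa using (eq_freeWord (by norm_num) e).2.1
    | left i' j' _ h' => simpa using (eq_freeWord (by norm_num) e).2.1
    | free m' k' _ h' =>
      obtain ⟨rfl, rfl⟩ := freeWord_inj e
      rw [h, h']

theorem sphere_eq (n : ℕ) : bouncer.sphere n = {x | Layer n x} := by
  ext x
  simp only [Multiway.sphere, stepN_iff_layer, Set.mem_ofPred_eq, and_iff_left_iff_imp]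
  exact fun hx k hk hx' => hk.ne (hx'.unique hx)

theorem sphere_subset (n : ℕ) : bouncer.sphere n ⊆
    (((Finset.range n.sqrt).image fun m => freeWord m (n - (m + 1) ^ 2)) ∪
      {rightWord (n - n.sqrt ^ 2 - n.sqrt) (n.sqrt - (n - n.sqrt ^ 2 - n.sqrt)),
        leftWord (n.sqrt - 1 - (n - n.sqrt ^ 2)) (n - n.sqrt ^ 2)} : Finset (List ℕ)) := by
  rw [sphere_eq]
  rintro x (⟨i, j, _, h⟩ | ⟨i, j, _, h⟩ | ⟨m, k, _, h⟩)
  · have hs : n.sqrt = i + j := by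
      refine (Nat.eq_sqrt'.2 ⟨?_, ?_⟩).symm <;> nlinarith
    have hi : n - n.sqrt ^ 2 - n.sqrt = i := by
      rw [hs, h, Nat.sub_sub]
      exact Nat.sub_eq_of_eq_add (by ring)
    have hj : n.sqrt - i = j := by omega
    rw [hi, hj]
    simp
  · have hs : n.sqrt = i + j + 1 := by
      refine (Nat.eq_sqrt'.2 ⟨?_, ?_⟩).symm
      · omega
      · have : (i + j + 1 + 1) ^ 2 = (i + j + 1) ^ 2 + (2 * i + 2 * j + 3) := by ring
        omega
    have hj : n - n.sqrt ^ 2 = j := by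
      rw [hs, h]
      simp
    have hi : n.sqrt - 1 - j = i := by omega
    rw [hj, hi]
    simp
  · have hs : m + 1 ≤ n.sqrt := Nat.le_sqrt'.2 (by omega)
    have hk : n - (m + 1) ^ 2 = k := by omega
    simp only [Finset.coe_union, Set.mem_union, Finset.mem_coe, Finset.mem_image, Finset.mem_range]
    exact .inl ⟨m, hs, by rw [hk]⟩

theorem growth_le (n : ℕ) : bouncer.growth n ≤ n.sqrt + 2 := by
  refine (Set.ncard_le_ncard (sphere_subset n) (Finset.finite_toSet _)).trans ?_
  rw [Set.ncard_coe_finset]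
  refine (Finset.card_union_le _ _).trans (add_le_add ?_ Finset.card_le_two)
  exact Finset.card_image_le.trans (Finset.card_range _).le

theorem sqrt_le_growth (n : ℕ) : n.sqrt ≤ bouncer.growth n := by
  have hfin : (bouncer.sphere n).Finite := (Finset.finite_toSet _).subset (sphere_subset n)
  have hcard : ((Finset.range n.sqrt).image fun m => freeWord m (n - (m + 1) ^ 2)).card
      = n.sqrt := by
    rw [Finset.card_image_of_injective, Finset.card_range]
    exact fun m m' h => (freeWord_inj h).1
  rw [← hcard, ← Set.ncard_coe_finset]
  refine Set.ncard_le_ncard ?_ hfin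
  rw [sphere_eq]
  intro x hx
  simp only [Finset.coe_image, Set.mem_image, Finset.mem_coe, Finset.mem_range] at hx
  obtain ⟨m, hm, rfl⟩ := hx
  have := Nat.le_sqrt'.1 (Nat.succ_le_of_lt hm)
  exact .free _ _ _ (by simp only [Nat.succ_eq_add_one] at this; omega)

end bouncer

/-- there exists a multiway system whose growth function is `Θ(√n)`; in
particular the growth class of inverses of polynomials is nonempty. -/
theorem exists_multiway_of_sqrt_growth :
    ∃ M : Multiway, ∃ c C : ℝ, 0 < c ∧ c ≤ C ∧ ∃ N : ℕ, ∀ n : ℕ, N ≤ n →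
      c * Real.sqrt (n : ℝ) ≤ (M.growth n : ℝ) ∧
      (M.growth n : ℝ) ≤ C * Real.sqrt (n : ℝ) := by
  refine ⟨bouncer, 1 / 2, 3, by norm_num, by norm_num, 1, fun n hn => ?_⟩
  have h1 : (n.sqrt : ℝ) ≤ bouncer.growth n := by exact_mod_cast bouncer.sqrt_le_growth n
  have h2 : (bouncer.growth n : ℝ) ≤ n.sqrt + 2 := by exact_mod_cast bouncer.growth_le n
  have h3 : (n.sqrt : ℝ) ≤ √n := Real.nat_sqrt_le_real_sqrt
  have h4 : √n ≤ n.sqrt + 1 := Real.real_sqrt_le_nat_sqrt_succ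
  have h5 : (1 : ℝ) ≤ n.sqrt := by exact_mod_cast Nat.sqrt_pos.2 hn
  constructor <;> linarith
end

section
/- For every integer a ≥ 1, the sum ∑_{k=1}^{n−1} k^a · ln(n − k) is Θ(n^{a+1} · ln n) as n → ∞: there exist constants 0 < c ≤ C and N such that c · n^{a+1} ln n ≤ ∑_{k=1}^{n−1} k^a ln(n−k) ≤ C · n^{a+1} ln n for all n ≥ N. (Consequently, the discrete convolution of a polynomially growing multiway growth function with a logarithmically growing one is Θ(n^{a+1} ln n), so n^{a+1} ln n is multiway-growth-approximable.) -/
/-- for every `a ≥ 1`, `∑_{k=1}^{n-1} k^a · ln (n - k)` is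
`Θ(n^{a+1} · ln n)`. -/
theorem sum_pow_mul_log_theta (a : ℕ) (ha : 1 ≤ a) :
    ∃ c C : ℝ, 0 < c ∧ c ≤ C ∧ ∃ N : ℕ, ∀ n : ℕ, N ≤ n →
      c * (n : ℝ) ^ (a + 1) * Real.log (n : ℝ) ≤
        (∑ k ∈ Finset.Ico 1 n, (k : ℝ) ^ a * Real.log ((n : ℝ) - (k : ℝ))) ∧
      (∑ k ∈ Finset.Ico 1 n, (k : ℝ) ^ a * Real.log ((n : ℝ) - (k : ℝ))) ≤
        C * (n : ℝ) ^ (a + 1) * Real.log (n : ℝ) := by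
  have hc : (1 / 4 : ℝ) ^ (a + 1) ≤ 1 := pow_le_one₀ (by norm_num) (by norm_num)
  refine ⟨(1 / 4 : ℝ) ^ (a + 1) / 2, 1, by positivity, by linarith, 16, fun n hn => ⟨?_, ?_⟩⟩
  · have hn' : (16 : ℝ) ≤ n := by exact_mod_cast hn
    have hm : (n : ℝ) / 4 ≤ (n / 3 : ℕ) := by
      have h : n ≤ 4 * (n / 3) := by omega
      have h' : (n : ℝ) ≤ 4 * (n / 3 : ℕ) := by exact_mod_cast h
      linarith
    have hlog : Real.log n / 2 ≤ Real.log ((n : ℝ) / 4) := by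
      have h : Real.log n ≤ Real.log (((n : ℝ) / 4) ^ 2) :=
        Real.log_le_log (by linarith) (by nlinarith)
      rw [Real.log_pow] at h
      push_cast at h
      linarith
    have hlog0 : 0 ≤ Real.log (n : ℝ) := Real.log_nonneg (by linarith)
    calc (1 / 4 : ℝ) ^ (a + 1) / 2 * (n : ℝ) ^ (a + 1) * Real.log n
        = (n / 4 : ℝ) * ((n / 4 : ℝ) ^ a * (Real.log n / 2)) := by
          rw [div_pow, div_pow, one_pow, pow_succ, pow_succ]
          field_simp
      _ ≤ (n / 3 : ℕ) * ((n / 4 : ℝ) ^ a * (Real.log n / 2)) := by gcongr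
      _ = ∑ k ∈ Finset.Ico (n / 3) (n / 3 + n / 3), (n / 4 : ℝ) ^ a * (Real.log n / 2) := by
          rw [Finset.sum_const, Nat.card_Ico, Nat.add_sub_cancel, nsmul_eq_mul]
      _ ≤ ∑ k ∈ Finset.Ico (n / 3) (n / 3 + n / 3),
            (k : ℝ) ^ a * Real.log ((n : ℝ) - (k : ℝ)) := by
          refine Finset.sum_le_sum fun k hk => ?_
          rw [Finset.mem_Ico] at hk
          have hk1 : ((n / 3 : ℕ) : ℝ) ≤ k := by exact_mod_cast hk.1
          have hk2 : (k : ℝ) + (n / 3 : ℕ) ≤ n := by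
            have h : k + n / 3 ≤ n := by omega
            exact_mod_cast h
          have hk3 : Real.log n / 2 ≤ Real.log ((n : ℝ) - k) :=
            hlog.trans (Real.log_le_log (by linarith) (by linarith))
          have hk4 : (n / 4 : ℝ) ≤ k := hm.trans hk1
          gcongr
      _ ≤ ∑ k ∈ Finset.Ico 1 n, (k : ℝ) ^ a * Real.log ((n : ℝ) - (k : ℝ)) := by
          refine Finset.sum_le_sum_of_subset_of_nonneg
            (Finset.Ico_subset_Ico (by omega) (by omega)) fun k hk _ => ?_
          have h : (k : ℝ) + 1 ≤ n := by exact_mod_cast (Finset.mem_Ico.mp hk).2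
          exact mul_nonneg (by positivity) (Real.log_nonneg (by linarith))
  · have hn' : (16 : ℝ) ≤ n := by exact_mod_cast hn
    have hlog0 : 0 ≤ Real.log (n : ℝ) := Real.log_nonneg (by linarith)
    calc ∑ k ∈ Finset.Ico 1 n, (k : ℝ) ^ a * Real.log ((n : ℝ) - (k : ℝ))
        ≤ ∑ k ∈ Finset.Ico 1 n, (n : ℝ) ^ a * Real.log n := by
          refine Finset.sum_le_sum fun k hk => ?_
          have h : (k : ℝ) + 1 ≤ n := by exact_mod_cast (Finset.mem_Ico.mp hk).2
          have hk0 : (0 : ℝ) ≤ k := k.cast_nonneg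
          have hl : Real.log ((n : ℝ) - k) ≤ Real.log n :=
            Real.log_le_log (by linarith) (by linarith)
          have hl0 : 0 ≤ Real.log ((n : ℝ) - k) := Real.log_nonneg (by linarith)
          have hkn : (k : ℝ) ≤ n := by linarith
          gcongr
      _ = ((n - 1 : ℕ) : ℝ) * ((n : ℝ) ^ a * Real.log n) := by
          rw [Finset.sum_const, Nat.card_Ico, nsmul_eq_mul]
      _ ≤ (n : ℝ) * ((n : ℝ) ^ a * Real.log n) := by
          gcongr
          exact Nat.sub_le n 1
      _ = 1 * (n : ℝ) ^ (a + 1) * Real.log n := by ring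
end

section
/- There exists a strongly oscillating multiway system: a multiway system M with growth function g_M and constants 0 < c ≤ C such that (i) c·n ≤ g_M(n) ≤ C·n² for all n ≥ 1, (ii) the set {n | g_M(n) ≥ c·n²} is infinite, and (iii) the set {n | g_M(n) ≤ C·n} is infinite. Consequently, the tightest monotone upper bound of g_M is Θ(n²) while the tightest monotone lower bound is Θ(n), so the two tight bounds of g_M lie in different asymptotic growth classes. -/
namespace OscillatingMultiway

/-- Symbols below `6` are tape letters (`0` and `1` are the left and right borders), the others are
heads.  Head `6` sweeps right and head `7` sweeps left, each doubling the block of `2`s it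
traverses; heads `8` and `9` are side branches of a right sweep, and die at its end; head `11`
produces the words `3ᵖ 11 4^q`. -/
def system : Multiway where
  rules := {([6, 2], [2, 2, 6]), ([6, 2], [3, 3, 8]), ([6, 1], [7, 2, 1]), ([2, 7], [7, 2, 2]),
    ([0, 7], [0, 2, 6]), ([8, 2], [3, 3, 8]), ([8, 2], [4, 4, 9]), ([9, 2], [4, 4, 9]),
    ([0, 7, 1], [3, 11, 4, 4]), ([11], [3, 11]), ([11], [11, 4])}
  init := [0, 7, 1]

/-- The tape with `i` letters `2` to the left of head `h` and `j` letters `2` to its right. -/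
def tape (h i j : ℕ) : List ℕ :=
  (0 :: List.replicate i 2) ++ h :: (List.replicate j 2 ++ [1])

/-- The left part of the tape in a side branch. -/
def branchWord (p q r : ℕ) : List ℕ :=
  0 :: (List.replicate p 2 ++ List.replicate q 3 ++ List.replicate r 4)

/-- The tape of a side branch. -/
def branch (h p q r j : ℕ) : List ℕ :=
  branchWord p q r ++ h :: (List.replicate j 2 ++ [1])

/-- The words produced by head `11`. -/
def linear (p q : ℕ) : List ℕ :=
  List.replicate p 3 ++ 11 :: List.replicate q 4

/-- One step of the sweeping head; the Boolean is `true` in a right sweep. -/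
def next : Bool × ℕ × ℕ → Bool × ℕ × ℕ
  | (true, i, j + 1) => (true, i + 2, j)
  | (true, i, 0) => (false, i, 1)
  | (false, i + 1, j) => (false, i, j + 2)
  | (false, 0, j) => (true, 1, j)

/-- The state of the sweeping head at time `n`. -/
def sweep : ℕ → Bool × ℕ × ℕ
  | 0 => (false, 0, 0)
  | n + 1 => next (sweep n)

/-- The tape of a state of the sweeping head. -/
def sweepTape (s : Bool × ℕ × ℕ) : List ℕ :=
  tape (if s.1 then 6 else 7) s.2.1 s.2.2

theorem sweep_add (n : ℕ) : (sweep n).2.1 + (sweep n).2.2 = n := by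
  induction n with
  | zero => rfl
  | succ n ih =>
    simp only [sweep]
    rcases h : sweep n with ⟨_ | _, _ | i, _ | j⟩ <;> simp [h, next] at ih ⊢ <;> omega

/-- A word with a single head splits in only one way at a head. -/
theorem split_unique {u v A B : List ℕ} {h h' : ℕ} (hh : 6 ≤ h) (hA : ∀ z ∈ A, z < 6)
    (hB : ∀ z ∈ B, z < 6) (e : A ++ h' :: B = u ++ h :: v) : A = u ∧ h' = h ∧ B = v := by
  induction A generalizing u with
  | nil =>
    cases u with
    | nil => simpa using e
    | cons a u =>
      simp only [List.nil_append, List.cons_append, List.cons.injEq] at e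
      have := hB h (by simp [e.2])
      omega
  | cons a A ih =>
    cases u with
    | nil =>
      simp only [List.nil_append, List.cons_append, List.cons.injEq] at e
      have := hA a (by simp)
      omega
    | cons b u =>
      simp only [List.cons_append, List.cons.injEq] at e
      have := ih (fun z hz => hA z (by simp [hz])) e.2
      exact ⟨by rw [e.1, this.1], this.2⟩

/-- All rewrites of a word with a single head. -/
theorem step_cases {A B y : List ℕ} {h : ℕ} (hA : ∀ z ∈ A, z < 6) (hB : ∀ z ∈ B, z < 6)
    (hs : system.Step (A ++ h :: B) y) :
    (h = 6 ∧ ∃ v, B = 2 :: v ∧ (y = A ++ 2 :: 2 :: 6 :: v ∨ y = A ++ 3 :: 3 :: 8 :: v)) ∨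
    (h = 6 ∧ ∃ v, B = 1 :: v ∧ y = A ++ 7 :: 2 :: 1 :: v) ∨
    (h = 7 ∧ ∃ u, A = u ++ [2] ∧ y = u ++ 7 :: 2 :: 2 :: B) ∨
    (h = 7 ∧ ∃ u, A = u ++ [0] ∧ y = u ++ 0 :: 2 :: 6 :: B) ∨
    (h = 8 ∧ ∃ v, B = 2 :: v ∧ (y = A ++ 3 :: 3 :: 8 :: v ∨ y = A ++ 4 :: 4 :: 9 :: v)) ∨
    (h = 9 ∧ ∃ v, B = 2 :: v ∧ y = A ++ 4 :: 4 :: 9 :: v) ∨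
    (h = 7 ∧ ∃ u v, A = u ++ [0] ∧ B = 1 :: v ∧ y = u ++ 3 :: 11 :: 4 :: 4 :: v) ∨
    (h = 11 ∧ (y = A ++ 3 :: 11 :: B ∨ y = A ++ 11 :: 4 :: B)) := by
  obtain ⟨p, hp, u, v, e, rfl⟩ := hs
  have key : ∀ (α β : List ℕ) (k : ℕ), p.1 = α ++ k :: β → 6 ≤ k →
      A = u ++ α ∧ h = k ∧ B = β ++ v := fun α β k hk h6 =>
    split_unique h6 hA hB (by rw [e, hk]; simp)
  clear e hA hB
  simp only [system, Finset.mem_insert, Finset.mem_singleton] at hp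
  rcases hp with rfl | rfl | rfl | rfl | rfl | rfl | rfl | rfl | rfl | rfl | rfl
  · obtain ⟨rfl, rfl, rfl⟩ := key [] [2] 6 rfl (by norm_num)
    exact .inl ⟨rfl, v, rfl, .inl (by simp)⟩
  · obtain ⟨rfl, rfl, rfl⟩ := key [] [2] 6 rfl (by norm_num)
    exact .inl ⟨rfl, v, rfl, .inr (by simp)⟩
  · obtain ⟨rfl, rfl, rfl⟩ := key [] [1] 6 rfl (by norm_num)
    exact .inr (.inl ⟨rfl, v, rfl, by simp⟩)
  · obtain ⟨rfl, rfl, rfl⟩ := key [2] [] 7 rfl (by norm_num)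
    exact .inr (.inr (.inl ⟨rfl, u, rfl, by simp⟩))
  · obtain ⟨rfl, rfl, rfl⟩ := key [0] [] 7 rfl (by norm_num)
    exact .inr (.inr (.inr (.inl ⟨rfl, u, rfl, by simp⟩)))
  · obtain ⟨rfl, rfl, rfl⟩ := key [] [2] 8 rfl (by norm_num)
    exact .inr (.inr (.inr (.inr (.inl ⟨rfl, v, rfl, .inl (by simp)⟩))))
  · obtain ⟨rfl, rfl, rfl⟩ := key [] [2] 8 rfl (by norm_num)
    exact .inr (.inr (.inr (.inr (.inl ⟨rfl, v, rfl, .inr (by simp)⟩))))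
  · obtain ⟨rfl, rfl, rfl⟩ := key [] [2] 9 rfl (by norm_num)
    exact .inr (.inr (.inr (.inr (.inr (.inl ⟨rfl, v, rfl, by simp⟩)))))
  · obtain ⟨rfl, rfl, rfl⟩ := key [0] [1] 7 rfl (by norm_num)
    exact .inr (.inr (.inr (.inr (.inr (.inr (.inl ⟨rfl, u, v, rfl, rfl, by simp⟩))))))
  · obtain ⟨rfl, rfl, rfl⟩ := key [] [] 11 rfl (by norm_num)
    exact .inr (.inr (.inr (.inr (.inr (.inr (.inr ⟨rfl, .inl (by simp)⟩))))))
  · obtain ⟨rfl, rfl, rfl⟩ := key [] [] 11 rfl (by norm_num)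
    exact .inr (.inr (.inr (.inr (.inr (.inr (.inr ⟨rfl, .inr (by simp)⟩))))))

theorem step_of_mem {r t : List ℕ} (h : (r, t) ∈ system.rules) (u v : List ℕ) {x y : List ℕ}
    (hx : x = u ++ r ++ v) (hy : y = u ++ t ++ v) : system.Step x y :=
  ⟨(r, t), h, u, v, hx, hy⟩

theorem length_of_step {x y : List ℕ} (hs : system.Step x y) : y.length = x.length + 1 := by
  obtain ⟨p, hp, u, v, rfl, rfl⟩ := hs
  simp only [system, Finset.mem_insert, Finset.mem_singleton] at hp
  rcases hp with rfl | rfl | rfl | rfl | rfl | rfl | rfl | rfl | rfl | rfl | rfl <;>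
    simp <;> omega

theorem length_of_stepN {n : ℕ} {x : List ℕ} (hs : system.StepN n x) : x.length = n + 3 := by
  induction n generalizing x with
  | zero => rw [show x = [0, 7, 1] from hs]; rfl
  | succ n ih =>
    obtain ⟨y, hy, hyx⟩ := hs
    rw [length_of_step hyx, ih hy]

theorem mem_sphere_iff {n : ℕ} {x : List ℕ} : x ∈ system.sphere n ↔ system.StepN n x :=
  ⟨fun h => h.1, fun h => ⟨h, fun k hk h' => by
    have := length_of_stepN h
    have := length_of_stepN h'
    omega⟩⟩

theorem replicate_append_cons (n a : ℕ) (l : List ℕ) :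
    List.replicate n a ++ a :: l = List.replicate (n + 1) a ++ l := by
  rw [List.replicate_succ']; simp

theorem branch_step_eight (p q j : ℕ) :
    system.Step (branch 8 p q 0 (j + 1)) (branch 8 p (q + 2) 0 j) :=
  step_of_mem (r := [8, 2]) (t := [3, 3, 8]) (by simp [system]) (branchWord p q 0)
    (List.replicate j 2 ++ [1]) (by simp [branch, List.replicate_succ])
    (by simp [branch, branchWord, replicate_append_cons])

theorem branch_step_eight_nine (p q j : ℕ) :
    system.Step (branch 8 p q 0 (j + 1)) (branch 9 p q 2 j) :=
  step_of_mem (r := [8, 2]) (t := [4, 4, 9]) (by simp [system]) (branchWord p q 0)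
    (List.replicate j 2 ++ [1]) (by simp [branch, List.replicate_succ])
    (by simp [branch, branchWord, List.replicate_succ])

theorem branch_step_nine (p q r j : ℕ) :
    system.Step (branch 9 p q r (j + 1)) (branch 9 p q (r + 2) j) :=
  step_of_mem (r := [9, 2]) (t := [4, 4, 9]) (by simp [system]) (branchWord p q r)
    (List.replicate j 2 ++ [1]) (by simp [branch, List.replicate_succ])
    (by simp [branch, branchWord, replicate_append_cons])

theorem tape_step_eight (i j : ℕ) :
    system.Step (tape 6 i (j + 1)) (branch 8 i 2 0 j) :=
  step_of_mem (r := [6, 2]) (t := [3, 3, 8]) (by simp [system]) (0 :: List.replicate i 2)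
    (List.replicate j 2 ++ [1]) (by simp [tape, List.replicate_succ])
    (by simp [branch, branchWord, List.replicate_succ])

theorem sweepTape_step (s : Bool × ℕ × ℕ) : system.Step (sweepTape s) (sweepTape (next s)) := by
  rcases s with ⟨_ | _, i, j⟩
  · cases i with
    | zero =>
      exact step_of_mem (r := [0, 7]) (t := [0, 2, 6]) (by simp [system]) []
        (List.replicate j 2 ++ [1]) (by simp [sweepTape, tape]) (by simp [sweepTape, tape, next])
    | succ i =>
      exact step_of_mem (r := [2, 7]) (t := [7, 2, 2]) (by simp [system])
        (0 :: List.replicate i 2) (List.replicate j 2 ++ [1])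
        (by simp [sweepTape, tape, replicate_append_cons])
        (by simp [sweepTape, tape, next, List.replicate_succ])
  · cases j with
    | zero =>
      exact step_of_mem (r := [6, 1]) (t := [7, 2, 1]) (by simp [system])
        (0 :: List.replicate i 2) [] (by simp [sweepTape, tape]) (by simp [sweepTape, tape, next])
    | succ j =>
      exact step_of_mem (r := [6, 2]) (t := [2, 2, 6]) (by simp [system])
        (0 :: List.replicate i 2) (List.replicate j 2 ++ [1])
        (by simp [sweepTape, tape, List.replicate_succ])
        (by simp [sweepTape, tape, next, replicate_append_cons])

theorem stepN_sweep (n : ℕ) : system.StepN n (sweepTape (sweep n)) := by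
  induction n with
  | zero => rfl
  | succ n ih => exact ⟨_, ih, sweepTape_step _⟩

theorem stepN_linear (i j : ℕ) : system.StepN (i + j + 1) (linear (i + 1) (j + 2)) := by
  induction i with
  | zero =>
    induction j with
    | zero =>
      exact ⟨_, rfl, step_of_mem (r := [0, 7, 1]) (t := [3, 11, 4, 4]) (by simp [system]) [] []
        rfl rfl⟩
    | succ j ih =>
      refine ⟨_, ih, step_of_mem (r := [11]) (t := [11, 4]) (by simp [system]) [3]
        (List.replicate (j + 2) 4) ?_ ?_⟩ <;> simp [linear, List.replicate_succ]
  | succ i ih =>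
    rw [show i + 1 + j + 1 = i + j + 1 + 1 by omega]
    refine ⟨_, ih, step_of_mem (r := [11]) (t := [3, 11]) (by simp [system])
      (List.replicate (i + 1) 3) (List.replicate (j + 2) 4) ?_ ?_⟩ <;>
      simp [linear, replicate_append_cons]

/-- Every word reached at time `n` is the sweep tape, a linear word or a side branch. -/
theorem cases_of_stepN {n : ℕ} {x : List ℕ} (hs : system.StepN n x) :
    x = sweepTape (sweep n) ∨ (∃ p q, p + q = n + 2 ∧ x = linear p q) ∨
    ((sweep n).1 = true ∧ ∃ h p q r, (h = 8 ∧ r = 0 ∨ h = 9) ∧ p + q + r = (sweep n).2.1 ∧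
      x = branch h p q r (sweep n).2.2) := by
  induction n generalizing x with
  | zero => left; exact hs
  | succ n ih =>
    obtain ⟨y, hy, hyx⟩ := hs
    rcases ih hy with rfl | ⟨p, q, hpq, rfl⟩ | ⟨hd, h, p, q, r, hh, hsum, rfl⟩
    · clear ih
      have hadd := sweep_add n
      simp only [sweep]
      generalize sweep n = s at *
      rcases s with ⟨d, i, j⟩
      have hc := step_cases (A := 0 :: List.replicate i 2) (B := List.replicate j 2 ++ [1])
        (by simp) (by simp; omega) hyx
      rcases d with _ | _
      · simp only [Bool.false_eq_true, if_false, Nat.reduceEqDiff, false_and, false_or, or_false,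
          true_and] at hc
        rcases hc with ⟨u, hu, rfl⟩ | ⟨u, hu, rfl⟩ | ⟨u, v, hu, hv, rfl⟩
        · left
          cases i with
          | zero => have := congrArg List.getLast? hu; simp at this
          | succ i =>
            rw [List.replicate_succ', ← List.cons_append, List.append_left_inj] at hu
            subst hu
            simp [sweepTape, tape, next, List.replicate_succ]
        · left
          cases i with
          | zero =>
            obtain rfl : u = [] := by simpa using hu
            simp [sweepTape, tape, next]
          | succ i =>
            rw [List.replicate_succ', ← List.cons_append] at hu
            have := (List.append_inj' hu rfl).2
            simp at this
        · right; left
          cases i with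
          | succ i =>
            rw [List.replicate_succ', ← List.cons_append] at hu
            have := (List.append_inj' hu rfl).2
            simp at this
          | zero =>
            obtain rfl : u = [] := by simpa using hu
            cases j with
            | succ j => simp [List.replicate_succ] at hv
            | zero =>
              obtain rfl : v = [] := by simpa using hv.symm
              obtain rfl : n = 0 := by simpa using hadd.symm
              exact ⟨1, 2, rfl, rfl⟩
      · simp only [if_true, Nat.reduceEqDiff, false_and, or_false, true_and] at hc
        cases j with
        | zero =>
          simp only [List.replicate_zero, List.nil_append, List.cons.injEq,
            OfNat.one_ne_ofNat, false_and, exists_false, false_or, true_and] at hc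
          obtain ⟨v, rfl, rfl⟩ := hc
          left
          simp [sweepTape, tape, next]
        | succ j =>
          simp only [List.replicate_succ, List.cons_append, List.cons.injEq, true_and,
            OfNat.ofNat_ne_one, false_and, exists_false, or_false] at hc
          obtain ⟨v, rfl, rfl | rfl⟩ := hc
          · left
            simp [sweepTape, tape, next, replicate_append_cons]
          · right; right
            exact ⟨rfl, 8, i, 2, 0, by simp, rfl,
              by simp [branch, branchWord, next, List.replicate_succ]⟩
    · have hc := step_cases (A := List.replicate p 3) (B := List.replicate q 4)
        (by simp) (by simp) hyx
      right; left
      simp only [Nat.reduceEqDiff, false_and, false_or, true_and] at hc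
      rcases hc with rfl | rfl
      · exact ⟨p + 1, q, by omega, by simp [linear, replicate_append_cons]⟩
      · exact ⟨p, q + 1, by omega, by simp [linear, List.replicate_succ]⟩
    · simp only [sweep]
      clear ih
      generalize sweep n = s at *
      rcases s with ⟨d, i, j⟩
      obtain rfl : d = true := hd
      have hc := step_cases (A := branchWord p q r) (B := List.replicate j 2 ++ [1])
        (by simp [branchWord]; omega) (by simp; omega) hyx
      right; right
      simp only at hsum
      cases j with
      | zero => rcases hh with ⟨rfl, rfl⟩ | rfl <;> simp at hc
      | succ j =>
        refine ⟨rfl, ?_⟩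
        simp only [next]
        rcases hh with ⟨rfl, rfl⟩ | rfl
        · simp only [Nat.reduceEqDiff, false_and, false_or, or_false, true_and,
            List.replicate_succ, List.cons_append, List.cons.injEq] at hc
          obtain ⟨v, rfl, rfl | rfl⟩ := hc
          · exact ⟨8, p, q + 2, 0, by simp, by omega,
              by simp [branch, branchWord, replicate_append_cons]⟩
          · exact ⟨9, p, q, 2, by simp, by omega,
              by simp [branch, branchWord, List.replicate_succ]⟩
        · simp only [Nat.reduceEqDiff, false_and, false_or, or_false, true_and,
            List.replicate_succ, List.cons_append, List.cons.injEq] at hc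
          obtain ⟨v, rfl, rfl⟩ := hc
          exact ⟨9, p, q, r + 2, by simp, by omega,
            by simp [branch, branchWord, replicate_append_cons]⟩

/-- The linear words of length `n + 3`. -/
def linearWords (n : ℕ) : Finset (List ℕ) :=
  (Finset.range (n + 3)).image fun p => linear p (n + 2 - p)

/-- The side branches with `i` letters between the left border and the head. -/
def branches (i j : ℕ) : Finset (List ℕ) :=
  (Finset.range 2 ×ˢ Finset.range (i + 1) ×ˢ Finset.range (i + 1)).image fun t =>
    branch (8 + t.1) t.2.1 t.2.2 (i - t.2.1 - t.2.2) j

theorem card_linearWords_le (n : ℕ) : (linearWords n).card ≤ n + 3 :=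
  Finset.card_image_le.trans (by simp)

theorem card_branches_le (i j : ℕ) : (branches i j).card ≤ 2 * ((i + 1) * (i + 1)) :=
  Finset.card_image_le.trans (by simp)

theorem sphere_subset (n : ℕ) : system.sphere n ⊆
    ({sweepTape (sweep n)} ∪ linearWords n ∪
      if (sweep n).1 then branches (sweep n).2.1 (sweep n).2.2 else ∅ : Finset (List ℕ)) := by
  intro x hx
  rw [Finset.mem_coe, Finset.mem_union, Finset.mem_union, Finset.mem_singleton]
  rcases cases_of_stepN hx.1 with h | ⟨p, q, hpq, rfl⟩ | ⟨hd, h, p, q, r, hh, hsum, rfl⟩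
  · exact .inl (.inl h)
  · refine .inl (.inr (Finset.mem_image.2 ⟨p, by simp; omega, ?_⟩))
    rw [← hpq, Nat.add_sub_cancel_left]
  · right
    rw [if_pos hd]
    refine Finset.mem_image.2 ⟨(h - 8, p, q), by simp; omega, ?_⟩
    rw [show 8 + (h - 8) = h by omega, ← hsum]
    simp only [show p + q + r - p - q = r by omega]

theorem finite_sphere (n : ℕ) : (system.sphere n).Finite :=
  (Finset.finite_toSet _).subset (sphere_subset n)

theorem growth_le (n : ℕ) : system.growth n ≤ n + 4 + 2 * ((n + 1) * (n + 1)) := by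
  have h := Set.ncard_le_ncard (sphere_subset n) (Finset.finite_toSet _)
  rw [Set.ncard_coe_finset] at h
  refine h.trans ((Finset.card_union_le _ _).trans (Nat.add_le_add
    ((Finset.card_union_le _ _).trans ?_) ?_))
  · have := card_linearWords_le n
    rw [Finset.card_singleton]; omega
  · split
    · have hi : (sweep n).2.1 ≤ n := by have := sweep_add n; omega
      refine (card_branches_le _ _).trans ?_
      gcongr
    · simp

theorem growth_le_of_left_sweep {n : ℕ} (hn : (sweep n).1 = false) :
    system.growth n ≤ n + 4 := by
  have h := Set.ncard_le_ncard (sphere_subset n) (Finset.finite_toSet _)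
  rw [Set.ncard_coe_finset] at h
  simp only [hn, Bool.false_eq_true, if_false, Finset.union_empty] at h
  have h2 := h.trans (Finset.card_union_le _ _)
  have := card_linearWords_le n
  rw [Finset.card_singleton] at h2
  rw [Multiway.growth]
  omega

theorem le_growth (n : ℕ) : n ≤ system.growth n := by
  have hsub : (((Finset.range n).image fun i => linear (i + 1) (n - 1 - i + 2) :
      Finset (List ℕ)) : Set (List ℕ)) ⊆ system.sphere n := by
    intro x hx
    obtain ⟨i, hi, rfl⟩ := Finset.mem_image.1 (Finset.mem_coe.1 hx)
    rw [Finset.mem_range] at hi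
    rw [mem_sphere_iff]
    convert stepN_linear i (n - 1 - i) using 1
    omega
  have h := Set.ncard_le_ncard hsub (finite_sphere n)
  rw [Set.ncard_coe_finset, Finset.card_image_of_injOn, Finset.card_range] at h
  · exact h
  · intro i _ i' _ e
    have := congrArg (List.count 3) e
    simpa [linear, List.count_replicate] using this

theorem sweep_right {n i j : ℕ} (h : sweep n = (true, i, j)) {t : ℕ} (ht : t ≤ j) :
    sweep (n + t) = (true, i + 2 * t, j - t) := by
  induction t with
  | zero => exact h
  | succ t ih =>
    rw [← add_assoc, sweep, ih (by omega), show j - t = j - (t + 1) + 1 by omega]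
    rfl

theorem sweep_left {n i j : ℕ} (h : sweep n = (false, i, j)) {t : ℕ} (ht : t ≤ i) :
    sweep (n + t) = (false, i - t, j + 2 * t) := by
  induction t with
  | zero => exact h
  | succ t ih =>
    rw [← add_assoc, sweep, ih (by omega), show i - t = i - (t + 1) + 1 by omega]
    rfl

theorem exists_left_border (N : ℕ) : ∃ n ≥ N, sweep n = (false, 0, n) := by
  induction N with
  | zero => exact ⟨0, le_rfl, rfl⟩
  | succ N ih =>
    obtain ⟨n, hn, h⟩ := ih
    have h1 : sweep (n + 1) = (true, 1, n) := by rw [sweep, h]; rfl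
    have h2 := sweep_right h1 le_rfl
    have h3 : sweep (n + 1 + n + 1) = (false, 1 + 2 * n, 1) := by
      rw [sweep, h2, Nat.sub_self]; rfl
    have h4 := sweep_left h3 le_rfl
    refine ⟨n + 1 + n + 1 + (1 + 2 * n), by omega, ?_⟩
    rw [h4]
    simp only [Prod.mk.injEq, true_and]
    omega

theorem stepN_branch_eight {n i j : ℕ} (h : sweep n = (true, i, j)) {q : ℕ} (hq : q + 1 ≤ j) :
    system.StepN (n + (q + 1)) (branch 8 i (2 * (q + 1)) 0 (j - (q + 1))) := by
  induction q with
  | zero =>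
    obtain ⟨j, rfl⟩ : ∃ k, j = k + 1 := ⟨j - 1, by omega⟩
    have hs := stepN_sweep n
    rw [h] at hs
    exact ⟨_, hs, tape_step_eight i j⟩
  | succ q ih =>
    refine ⟨_, ih (by omega), ?_⟩
    rw [show j - (q + 1) = j - (q + 1 + 1) + 1 by omega]
    exact branch_step_eight i (2 * (q + 1)) _

theorem stepN_branch_nine {n i j : ℕ} (h : sweep n = (true, i, j)) {q r : ℕ}
    (hq : q + 1 + (r + 1) ≤ j) :
    system.StepN (n + (q + 1) + (r + 1))
      (branch 9 i (2 * (q + 1)) (2 * (r + 1)) (j - (q + 1) - (r + 1))) := by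
  induction r with
  | zero =>
    refine ⟨_, stepN_branch_eight h (q := q) (by omega), ?_⟩
    rw [show j - (q + 1) = j - (q + 1) - (0 + 1) + 1 by omega]
    exact branch_step_eight_nine i (2 * (q + 1)) _
  | succ r ih =>
    refine ⟨_, ih (by omega), ?_⟩
    rw [show j - (q + 1) - (r + 1) = j - (q + 1) - (r + 1 + 1) + 1 by omega]
    exact branch_step_nine i (2 * (q + 1)) (2 * (r + 1)) _

/-- At the end of a right sweep there are quadratically many side branches. -/
theorem growth_ge_of_left_border {n : ℕ} (h : sweep n = (false, 0, n)) :
    n / 2 * (n / 2) ≤ system.growth (2 * n + 1) := by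
  have h1 : sweep (n + 1) = (true, 1, n) := by rw [sweep, h]; rfl
  have hsub : (((Finset.range (n / 2) ×ˢ Finset.range (n / 2)).image fun t =>
      branch 9 (1 + 2 * (n - (t.1 + 1) - (t.2 + 1))) (2 * (t.1 + 1)) (2 * (t.2 + 1)) 0 :
      Finset (List ℕ)) : Set (List ℕ)) ⊆ system.sphere (2 * n + 1) := by
    intro x hx
    obtain ⟨⟨q, r⟩, ht, rfl⟩ := Finset.mem_image.1 (Finset.mem_coe.1 hx)
    simp only [Finset.mem_product, Finset.mem_range] at ht
    rw [mem_sphere_iff]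
    have h2 := sweep_right h1 (t := n - (q + 1) - (r + 1)) (by omega)
    have h3 := stepN_branch_nine h2 (q := q) (r := r) (by omega)
    rw [show n + 1 + (n - (q + 1) - (r + 1)) + (q + 1) + (r + 1) = 2 * n + 1 by omega,
      show n - (n - (q + 1) - (r + 1)) - (q + 1) - (r + 1) = 0 by omega] at h3
    exact h3
  have hle := Set.ncard_le_ncard hsub (finite_sphere _)
  rw [Set.ncard_coe_finset, Finset.card_image_of_injOn, Finset.card_product,
    Finset.card_range] at hle
  · exact hle
  · rintro ⟨q, r⟩ _ ⟨q', r'⟩ _ e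
    have e3 := congrArg (List.count 3) e
    have e4 := congrArg (List.count 4) e
    simp [branch, branchWord, List.count_replicate] at e3 e4
    simp [e3, e4]

end OscillatingMultiway

/-- there exists a strongly oscillating multiway system: its growth function
is squeezed between `c·n` and `C·n²`, attains `c·n²` infinitely often and `C·n` infinitely
often, so its tight monotone upper and lower bounds lie in different growth classes. -/
theorem exists_strongly_oscillating_multiway :
    ∃ M : Multiway, ∃ c C : ℝ, 0 < c ∧ c ≤ C ∧
      (∀ n : ℕ, 1 ≤ n →
        c * (n : ℝ) ≤ (M.growth n : ℝ) ∧ (M.growth n : ℝ) ≤ C * (n : ℝ) ^ 2) ∧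
      {n : ℕ | c * (n : ℝ) ^ 2 ≤ (M.growth n : ℝ)}.Infinite ∧
      {n : ℕ | (M.growth n : ℝ) ≤ C * (n : ℝ)}.Infinite := by
  refine ⟨OscillatingMultiway.system, 1 / 100, 20, by norm_num, by norm_num, fun n hn => ⟨?_, ?_⟩,
    Set.infinite_of_forall_exists_gt fun N => ?_, Set.infinite_of_forall_exists_gt fun N => ?_⟩
  · have h : (n : ℝ) ≤ OscillatingMultiway.system.growth n :=
      mod_cast OscillatingMultiway.le_growth n
    linarith [n.cast_nonneg (α := ℝ)]
  · have h : (OscillatingMultiway.system.growth n : ℝ) ≤ n + 4 + 2 * ((n + 1) * (n + 1)) :=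
      mod_cast OscillatingMultiway.growth_le n
    have h1 : (1 : ℝ) ≤ n := mod_cast hn
    nlinarith
  · obtain ⟨n, hn, h⟩ := OscillatingMultiway.exists_left_border (N + 3)
    refine ⟨2 * n + 1, ?_, by omega⟩
    have hg : ((n / 2 : ℕ) : ℝ) * (n / 2 : ℕ) ≤ OscillatingMultiway.system.growth (2 * n + 1) :=
      mod_cast OscillatingMultiway.growth_ge_of_left_border h
    have h2 : ((2 * n + 1 : ℕ) : ℝ) ≤ 7 * (n / 2 : ℕ) := by
      exact_mod_cast (by omega : 2 * n + 1 ≤ 7 * (n / 2))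
    have h3 : (0 : ℝ) ≤ ((2 * n + 1 : ℕ) : ℝ) := Nat.cast_nonneg _
    simp only [Set.mem_ofPred_eq]
    nlinarith
  · obtain ⟨n, hn, h⟩ := OscillatingMultiway.exists_left_border (N + 1)
    refine ⟨n, ?_, by omega⟩
    have hg : (OscillatingMultiway.system.growth n : ℝ) ≤ n + 4 :=
      mod_cast OscillatingMultiway.growth_le_of_left_sweep (by rw [h])
    have h1 : (1 : ℝ) ≤ n := mod_cast (by omega : 1 ≤ n)
    simp only [Set.mem_ofPred_eq]
    linarith
end
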